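/- Diagonality and the symmetric Kronecker product: for A, B ∈ ℝ^{n×n}, (i) if A and B are diagonal then A ⊗ₛ B is diagonal; (ii) conversely, if every diagonal entry of A and of B is nonzero and A ⊗ₛ B is diagonal, then A and B are diagonal. -/

import Mathlib

open Matrix

noncomputable section

/-- `n̄ = n(n+1)/2`, the dimension of the space of symmetric `n × n` matrices. -/
def triDim (n : ℕ) : ℕ := n * (n + 1) / 2

/-- The (0-based) row/column pair `(r(j), c(j))` of the `j`-th position in the
lexicographic (left-to-right, top-to-bottom) enumeration of the on-or-above-diagonal
positions of an `n × n` matrix. -/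
def rcPair : ℕ → ℕ → ℕ × ℕ
  | 0, _ => (0, 0)
  | (m + 1), j =>
      if j < m + 1 then (0, j)
      else ((rcPair m (j - (m + 1))).1 + 1, (rcPair m (j - (m + 1))).2 + 1)

/-- The orthonormal basis `E_j` of the space of symmetric `n × n` matrices:
`E_j = e_{r(j)} e_{c(j)}ᵀ` if `r(j) = c(j)`, and
`E_j = (√2/2) (e_{r(j)} e_{c(j)}ᵀ + e_{c(j)} e_{r(j)}ᵀ)` if `r(j) < c(j)`. -/
def symBasis (n : ℕ) (j : Fin (triDim n)) : Matrix (Fin n) (Fin n) ℝ :=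
  if (rcPair n j).1 = (rcPair n j).2 then
    Matrix.of fun a b : Fin n =>
      if (a : ℕ) = (rcPair n j).1 ∧ (b : ℕ) = (rcPair n j).2 then (1 : ℝ) else 0
  else
    Matrix.of fun a b : Fin n =>
      if ((a : ℕ) = (rcPair n j).1 ∧ (b : ℕ) = (rcPair n j).2) ∨
          ((a : ℕ) = (rcPair n j).2 ∧ (b : ℕ) = (rcPair n j).1) then
        Real.sqrt 2 / 2
      else 0

/-- Column-stacking vectorization `vec : ℝ^{m×n} → ℝ^{nm}`: `vec(A)_{j·m + i} = A_{i,j}`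
(0-based), realized through `finProdFinEquiv (j, i) = j * m + i`. -/
def mvec {m n : ℕ} (A : Matrix (Fin m) (Fin n) ℝ) : Fin (n * m) → ℝ :=
  fun k => A (finProdFinEquiv.symm k).2 (finProdFinEquiv.symm k).1

/-- The matrix `W_n ∈ ℝ^{n̄ × n²}` whose `j`-th row is `vec(E_j)ᵀ`. -/
def Wmat (n : ℕ) : Matrix (Fin (triDim n)) (Fin (n * n)) ℝ :=
  Matrix.of fun j k => mvec (symBasis n j) k

/-- The Kronecker product on `Fin`-indexed matrices, with the standard flattening
`(A ⊗ B)_{(i·p + k, j·q + l)} = A_{i,j} B_{k,l}`. -/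
def kron {m n p q : ℕ} (A : Matrix (Fin m) (Fin n) ℝ) (B : Matrix (Fin p) (Fin q) ℝ) :
    Matrix (Fin (m * p)) (Fin (n * q)) ℝ :=
  Matrix.reindex finProdFinEquiv finProdFinEquiv (Matrix.kroneckerMap (· * ·) A B)

/-- The symmetric Kronecker product `A ⊗ₛ B = W_m (A ⊗ B) W_nᵀ ∈ ℝ^{m̄ × n̄}`
of rectangular matrices `A, B ∈ ℝ^{m×n}`. -/
def skron {m n : ℕ} (A B : Matrix (Fin m) (Fin n) ℝ) :
    Matrix (Fin (triDim m)) (Fin (triDim n)) ℝ :=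
  Wmat m * kron A B * (Wmat n)ᵀ

/-- The Frobenius inner product `⟨A, B⟩_F = trace(Aᵀ B)`. -/
def frobInner {m n : ℕ} (A B : Matrix (Fin m) (Fin n) ℝ) : ℝ :=
  (Aᵀ * B).trace

/-- Symmetric vectorization `svec(P)_j = ⟨P, E_j⟩_F`. -/
def svec {n : ℕ} (P : Matrix (Fin n) (Fin n) ℝ) : Fin (triDim n) → ℝ :=
  fun j => frobInner P (symBasis n j)

/-- The symmetric part `π(A) = (A + Aᵀ)/2`. -/
def symPart {n : ℕ} (A : Matrix (Fin n) (Fin n) ℝ) : Matrix (Fin n) (Fin n) ℝ :=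
  (1 / 2 : ℝ) • (A + Aᵀ)

/-- The symmetric Kronecker sum `A ⊕ₛ B = A ⊗ₛ I + I ⊗ₛ B`. -/
def skronSum {n : ℕ} (A B : Matrix (Fin n) (Fin n) ℝ) :
    Matrix (Fin (triDim n)) (Fin (triDim n)) ℝ :=
  skron A 1 + skron 1 B

/-- A vector `x ∈ ℝⁿ` regarded as an `n × 1` matrix. -/
def colVec {n : ℕ} (x : Fin n → ℝ) : Matrix (Fin n) (Fin 1) ℝ :=
  Matrix.of fun i _ => x i

theorem triDim_succ (m : ℕ) : triDim (m + 1) = (m + 1) + triDim m := by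
  unfold triDim
  rw [show (m + 1) * (m + 1 + 1) = m * (m + 1) + (m + 1) * 2 by ring,
    Nat.add_mul_div_right _ _ two_pos, add_comm]

theorem rcPair_le_lt (n j : ℕ) (hj : j < triDim n) :
    (rcPair n j).1 ≤ (rcPair n j).2 ∧ (rcPair n j).2 < n := by
  induction n generalizing j with
  | zero => simp [triDim] at hj
  | succ m ih =>
    rw [triDim_succ] at hj
    rw [rcPair]
    split_ifs with h
    · exact ⟨Nat.zero_le _, h⟩
    · have := ih (j - (m + 1)) (by omega)
      dsimp only
      omega

theorem rcPair_inj (n j k : ℕ) (hj : j < triDim n) (hk : k < triDim n)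
    (h : rcPair n j = rcPair n k) : j = k := by
  induction n generalizing j k with
  | zero => simp [triDim] at hj
  | succ m ih =>
    rw [triDim_succ] at hj hk
    rw [rcPair, rcPair] at h
    split_ifs at h with h₁ h₂ h₂
    · simpa using h
    · simp at h
    · simp at h
    · simp only [Prod.mk.injEq, add_left_inj] at h
      have := ih (j - (m + 1)) (k - (m + 1)) (by omega) (by omega) (Prod.ext h.1 h.2)
      omega

theorem exists_rcPair_eq (n r c : ℕ) (hrc : r ≤ c) (hc : c < n) :
    ∃ j, j < triDim n ∧ rcPair n j = (r, c) := by
  induction n generalizing r c with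
  | zero => omega
  | succ m ih =>
    rcases r with _ | r
    · exact ⟨c, by rw [triDim_succ]; omega, by rw [rcPair, if_pos hc]⟩
    · obtain ⟨j, hj, h⟩ := ih r (c - 1) (by omega) (by omega)
      refine ⟨m + 1 + j, by rw [triDim_succ]; omega, ?_⟩
      rw [rcPair, if_neg (by omega), Nat.add_sub_cancel_left, h]
      simp only [Prod.mk.injEq, true_and]
      omega

theorem symBasis_ne_zero {n : ℕ} {j : Fin (triDim n)} {a b : Fin n}
    (h : symBasis n j a b ≠ 0) : rcPair n j = (min (a : ℕ) b, max (a : ℕ) b) := by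
  have hle := (rcPair_le_lt n j j.2).1
  unfold symBasis at h
  split_ifs at h with h₁
  · simp only [of_apply, ne_eq, ite_eq_right_iff, one_ne_zero, imp_false, not_not] at h
    ext <;> dsimp only <;> omega
  · rw [of_apply] at h
    have h₂ := (ite_ne_right_iff.1 h).1
    ext <;> dsimp only <;> omega

/-- Two basis matrices with overlapping supports coincide. -/
theorem eq_of_symBasis_ne_zero {n : ℕ} {j k : Fin (triDim n)} {a b : Fin n}
    (hj : symBasis n j a b ≠ 0) (hk : symBasis n k a b ≠ 0) : j = k :=
  Fin.ext <| rcPair_inj n j k j.2 k.2 ((symBasis_ne_zero hj).trans (symBasis_ne_zero hk).symm)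

theorem exists_symBasis_eq_single {n : ℕ} (i : Fin n) :
    ∃ j, symBasis n j = single i i 1 := by
  obtain ⟨j, hj, h⟩ := exists_rcPair_eq n i i le_rfl i.2
  refine ⟨⟨j, hj⟩, ?_⟩
  ext a b
  simp [symBasis, h, single_apply, Fin.ext_iff, eq_comm]

theorem exists_symBasis_eq_add {n : ℕ} {p q : Fin n} (hpq : p ≠ q) :
    ∃ j, symBasis n j = (√2 / 2) • (single p q 1 + single q p 1) := by
  wlog hlt : p < q generalizing p q
  · obtain ⟨j, hj⟩ := this hpq.symm (lt_of_le_of_ne (not_lt.1 hlt) hpq.symm)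
    exact ⟨j, by rw [hj, add_comm]⟩
  obtain ⟨j, hj, h⟩ := exists_rcPair_eq n p q hlt.le q.2
  refine ⟨⟨j, hj⟩, ?_⟩
  ext a b
  simp only [symBasis, h, if_neg hpq, of_apply, Matrix.smul_apply,
    Matrix.add_apply, single_apply, smul_eq_mul, ← Fin.ext_iff]
  grind

theorem skron_apply {m n : ℕ} (A B : Matrix (Fin m) (Fin n) ℝ) (j : Fin (triDim m))
    (k : Fin (triDim n)) :
    skron A B j k = ∑ u, ∑ v, (∑ x, ∑ y, symBasis m j y x * (A x u * B y v)) *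
      symBasis n k v u := by
  simp only [skron, mul_apply, transpose_apply, Wmat, of_apply, mvec, kron, reindex_apply,
    submatrix_apply, kroneckerMap_apply]
  rw [← finProdFinEquiv.sum_comp, Fintype.sum_prod_type]
  refine Finset.sum_congr rfl fun u _ => Finset.sum_congr rfl fun v _ => ?_
  rw [← finProdFinEquiv.sum_comp, Fintype.sum_prod_type]
  simp only [Equiv.symm_apply_apply]

theorem skron_apply_of_eq_single {m n : ℕ} (A B : Matrix (Fin m) (Fin n) ℝ)
    {j : Fin (triDim m)} {i : Fin m} (hj : symBasis m j = single i i 1) (k : Fin (triDim n)) :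
    skron A B j k = ∑ u, ∑ v, A i u * B i v * symBasis n k v u := by
  simp [skron_apply, hj, single_apply, ite_and]

theorem skron_isDiag_of_isDiag {n : ℕ} {A B : Matrix (Fin n) (Fin n) ℝ} (hA : A.IsDiag)
    (hB : B.IsDiag) : (skron A B).IsDiag := by
  intro j k hjk
  rw [skron_apply]
  refine Finset.sum_eq_zero fun u _ => Finset.sum_eq_zero fun v _ => ?_
  rw [Finset.sum_mul]
  refine Finset.sum_eq_zero fun x _ => ?_
  rw [Finset.sum_mul]
  refine Finset.sum_eq_zero fun y _ => ?_
  by_contra h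
  simp only [mul_eq_zero, not_or] at h
  obtain ⟨⟨hj, hAx, hBy⟩, hk⟩ := h
  obtain rfl : x = u := of_not_not fun hne => hAx (hA hne)
  obtain rfl : y = v := of_not_not fun hne => hBy (hB hne)
  exact hjk (eq_of_symBasis_ne_zero hj hk)

theorem isDiag_of_skron_isDiag {n : ℕ} {A B : Matrix (Fin n) (Fin n) ℝ}
    (hA : ∀ i, A i i ≠ 0) (hB : ∀ i, B i i ≠ 0) (h : (skron A B).IsDiag) :
    A.IsDiag ∧ B.IsDiag := by
  suffices key : ∀ p q, p ≠ q → A p q = 0 ∧ B p q = 0 from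
    ⟨fun p q hpq => (key p q hpq).1, fun p q hpq => (key p q hpq).2⟩
  intro p q hpq
  obtain ⟨j, hj⟩ := exists_symBasis_eq_single p
  obtain ⟨k, hk⟩ := exists_symBasis_eq_single q
  obtain ⟨l, hl⟩ := exists_symBasis_eq_add hpq
  have hjk : j ≠ k := by
    rintro rfl
    have := congr_fun₂ (hj.symm.trans hk) p p
    simp [hpq.symm] at this
  have hjl : j ≠ l := by
    rintro rfl
    have := congr_fun₂ (hj.symm.trans hl) p p
    simp [hpq.symm] at this
  have hprod : A p q * B p q = 0 := by
    have : skron A B j k = 0 := h hjk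
    rw [skron_apply_of_eq_single A B hj, hk] at this
    simpa [single_apply, ite_and] using this
  have hsum : A p p * B p q + A p q * B p p = 0 := by
    have : skron A B j l = 0 := h hjl
    rw [skron_apply_of_eq_single A B hj, hl] at this
    have hscaled : A p q * B p p * (√2 / 2) + A p p * B p q * (√2 / 2) = 0 := by
      simpa [single_apply, ite_and, mul_add, Finset.sum_add_distrib] using this
    have hfactor : (A p p * B p q + A p q * B p p) * (√2 / 2) = 0 := by
      linear_combination hscaled
    exact (mul_eq_zero.1 hfactor).resolve_right (by positivity)
  rcases mul_eq_zero.1 hprod with h₀ | h₀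
  · simpa [h₀, hA p] using hsum
  · simpa [h₀, hB p] using hsum

/-- (i) if `A` and `B` are diagonal then `A ⊗ₛ B` is diagonal;
(ii) if every diagonal entry of `A` and of `B` is nonzero and `A ⊗ₛ B` is diagonal,
then `A` and `B` are diagonal. -/
theorem skron_isDiag (n : ℕ) (A B : Matrix (Fin n) (Fin n) ℝ) :
    (A.IsDiag → B.IsDiag → (skron A B).IsDiag) ∧
    ((∀ i, A i i ≠ 0) → (∀ i, B i i ≠ 0) → (skron A B).IsDiag →
      A.IsDiag ∧ B.IsDiag) := by
  exact ⟨skron_isDiag_of_isDiag, isDiag_of_skron_isDiag⟩
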